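/- Let I = (f_1,…,f_n) be a generic ideal of type (n+1; d_1,…,d_n) in K[x_1,…,x_n,z] (with x_1 > ⋯ > x_n > z), let E = B(n+1; d_1,…,d_n) be its set of standard monomials with E_i the monomials of degree i in E, and let B = B(n; d_1,…,d_n) be the set of standard monomials of the image J of I under z ↦ 0. Then for 0 ≤ i ≤ δ one has E_i = B_i ∪ z·B_{i−1} ∪ z^2·B_{i−2} ∪ ⋯ ∪ z^{i−1}·B_1 ∪ z^i·B_0, and for i > δ one has E_i = z^{i−δ}·E_δ. -/

import Mathlib

open MvPolynomial

/-- The total degree of an exponent vector. -/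
def expDeg {n : ℕ} (μ : Fin n →₀ ℕ) : ℕ := μ.sum fun _ e => e

/-- Strict degree reverse lexicographic order on exponent vectors, for variables
`x_1 > ⋯ > x_n` (indexed by `Fin n` in this order). -/
def DrlLT {n : ℕ} (a b : Fin n →₀ ℕ) : Prop :=
  expDeg a < expDeg b ∨
    (expDeg a = expDeg b ∧ ∃ i : Fin n, b i < a i ∧ ∀ j : Fin n, i < j → a j = b j)

/-- `μ` is the leading (degrevlex-largest) exponent of `p`. -/
def IsLeadExp {n : ℕ} {K : Type*} [CommSemiring K] (p : MvPolynomial (Fin n) K)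
    (μ : Fin n →₀ ℕ) : Prop :=
  μ ∈ p.support ∧ ∀ ν ∈ p.support, ν ≠ μ → DrlLT ν μ

/-- The initial ideal of `I` with respect to the degree reverse lexicographic order. -/
noncomputable def initialIdeal {n : ℕ} {K : Type*} [CommRing K]
    (I : Ideal (MvPolynomial (Fin n) K)) : Ideal (MvPolynomial (Fin n) K) :=
  Ideal.span { m | ∃ p ∈ I, p ≠ 0 ∧ ∃ μ, IsLeadExp p μ ∧ m = monomial μ (1 : K) }

/-- The standard monomials of degree `i` of `I` : exponents of the monomials of degree `i`
not lying in the initial ideal of `I`. -/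
def stdMon {n : ℕ} {K : Type*} [CommRing K] (I : Ideal (MvPolynomial (Fin n) K)) (i : ℕ) :
    Set (Fin n →₀ ℕ) :=
  { μ | expDeg μ = i ∧ monomial μ (1 : K) ∉ initialIdeal I }

/-- `μ` is a minimal monomial generator of the monomial ideal `M`. -/
def IsMinGen {n : ℕ} {K : Type*} [CommRing K] (M : Ideal (MvPolynomial (Fin n) K))
    (μ : Fin n →₀ ℕ) : Prop :=
  monomial μ (1 : K) ∈ M ∧ ∀ ν : Fin n →₀ ℕ, ν ≤ μ → ν ≠ μ → monomial ν (1 : K) ∉ M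

/-- `μ` satisfies property `P` with respect to the monomial ideal `M`: if `m` is the largest
index of a variable dividing `x^μ`, then every monomial of the same degree in the variables of
index `< m` also lies in `M`. -/
def SatisfiesP {n : ℕ} {K : Type*} [CommRing K] (M : Ideal (MvPolynomial (Fin n) K))
    (μ : Fin n →₀ ℕ) : Prop :=
  ∀ m : Fin n, μ m ≠ 0 → (∀ j : Fin n, m < j → μ j = 0) →
    ∀ ν : Fin n →₀ ℕ, expDeg ν = expDeg μ → (∀ j : Fin n, m ≤ j → ν j = 0) →
      monomial ν (1 : K) ∈ M

/-- Conjecture E (Pardue) holds for the ideal `I`: every minimal generator of the initial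
ideal of `I` satisfies property `P`. -/
def ConjE {n : ℕ} {K : Type*} [CommRing K] (I : Ideal (MvPolynomial (Fin n) K)) : Prop :=
  ∀ μ, IsMinGen (initialIdeal I) μ → SatisfiesP (initialIdeal I) μ

/-- `f` is a generic sequence of forms of degrees `d i` over the base field `F`: each `f i` is
homogeneous of degree `d i` and the family of all coefficients (at all monomials of degree
`d i`) is algebraically independent over `F`. -/
def IsGenericSeq (F : Type*) {K : Type*} [CommRing F] [CommRing K] [Algebra F K]
    {n r : ℕ} (d : Fin r → ℕ) (f : Fin r → MvPolynomial (Fin n) K) : Prop :=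
  (∀ i, (f i).IsHomogeneous (d i)) ∧
    AlgebraicIndependent F
      (fun p : Σ i : Fin r, { μ : Fin n →₀ ℕ // expDeg μ = d i } => (f p.1).coeff p.2.1)

/-- The projection `K[x_1,…,x_n,z] → K[x_1,…,x_n]` sending `z` (the last variable) to `0` and
fixing the other variables. -/
noncomputable def projMap (K : Type*) [CommRing K] (n : ℕ) :
    MvPolynomial (Fin (n + 1)) K →ₐ[K] MvPolynomial (Fin n) K :=
  aeval (fun i => Fin.lastCases 0 (fun j => X j) i)

/-- Embedding of exponent vectors of `K[x_1,…,x_n]` into those of `K[x_1,…,x_n,z]`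
(`z`-exponent `0`). -/
noncomputable def embExp {n : ℕ} (μ : Fin n →₀ ℕ) : Fin (n + 1) →₀ ℕ :=
  Finsupp.embDomain ⟨Fin.castSucc, Fin.castSucc_injective n⟩ μ

/-- Multiplication by `z^c` on exponent vectors in `K[x_1,…,x_n,z]`. -/
noncomputable def zShift {n : ℕ} (c : ℕ) (μ : Fin (n + 1) →₀ ℕ) : Fin (n + 1) →₀ ℕ :=
  μ + Finsupp.single (Fin.last n) c

/-- `f` (homogeneous of degree `e`) is semi-regular on `R/I`: in each degree `t`, the
multiplication map `(R/I)_t → (R/I)_{t+e}` is injective or surjective. -/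
def SemiRegularOn {vars K : Type*} [CommRing K] (I : Ideal (MvPolynomial vars K))
    (f : MvPolynomial vars K) (e : ℕ) : Prop :=
  ∀ t : ℕ,
    (∀ p ∈ homogeneousSubmodule vars K t, f * p ∈ I → p ∈ I) ∨
    (∀ q ∈ homogeneousSubmodule vars K (t + e),
      ∃ p ∈ homogeneousSubmodule vars K t, q - f * p ∈ I)

/-- The degree-`t` graded piece of `R/I`, as a `K`-submodule of the quotient. -/
noncomputable def quotDegPart {vars K : Type*} [CommRing K] (I : Ideal (MvPolynomial vars K))
    (t : ℕ) : Submodule K (MvPolynomial vars K ⧸ I) :=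
  (homogeneousSubmodule vars K t).map (Ideal.Quotient.mkₐ K I).toLinearMap

/-! ### Products of powers of forms indexed by division with remainder of exponents -/

/-- The product `∏ gᵢ ^ (mᵢ / Dᵢ) * xᵢ ^ (mᵢ % Dᵢ)`. -/
noncomputable def divModProd {ι A : Type*} [Fintype ι] [CommRing A] (D : ι → ℕ)
    (g : ι → MvPolynomial ι A) (m : ι →₀ ℕ) : MvPolynomial ι A :=
  ∏ i, (g i ^ (m i / D i) * X i ^ (m i % D i))

section DivModProd

variable {ι A : Type*} [Fintype ι] [CommRing A] {D : ι → ℕ} {g : ι → MvPolynomial ι A}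

theorem map_divModProd {A' : Type*} [CommRing A'] (φ : A →+* A') (m : ι →₀ ℕ) :
    map φ (divModProd D g m) = divModProd D (fun i => map φ (g i)) m := by
  simp [divModProd, map_prod]

theorem divModProd_X_pow (m : ι →₀ ℕ) :
    divModProd D (fun i => (X i : MvPolynomial ι A) ^ D i) m = monomial m 1 := by
  rw [monomial_eq, Finsupp.prod_fintype _ _ (fun i => pow_zero _), C_1, one_mul]
  refine Finset.prod_congr rfl fun i _ => ?_
  rw [← pow_mul, ← pow_add, Nat.div_add_mod]

theorem isHomogeneous_divModProd (hg : ∀ i, (g i).IsHomogeneous (D i)) (m : ι →₀ ℕ) :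
    (divModProd D g m).IsHomogeneous m.degree := by
  rw [Finsupp.degree_eq_sum]
  refine IsHomogeneous.prod _ _ _ fun i _ => ?_
  have := ((hg i).pow (m i / D i)).mul (isHomogeneous_X_pow (R := A) i (m i % D i))
  rwa [Nat.div_add_mod] at this

theorem divModProd_add_single (m : ι →₀ ℕ) (j : ι) (hD : 0 < D j) :
    divModProd D g (m + Finsupp.single j (D j)) = g j * divModProd D g m := by
  classical
  have hg : g j = ∏ i, if i = j then g i else 1 := by simp
  rw [hg, divModProd, divModProd, ← Finset.prod_mul_distrib]
  refine Finset.prod_congr rfl fun i _ => ?_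
  by_cases h : i = j
  · subst h
    simp [Nat.add_div_right _ hD, pow_succ']
    ring
  · simp [h]

theorem divModProd_mem_span {κ : Type*} (c : κ → ι) (hD : ∀ i, 0 < D i) (m : ι →₀ ℕ) (k : κ)
    (hk : D (c k) ≤ m (c k)) :
    divModProd D g m ∈ Ideal.span (Set.range fun k => g (c k)) := by
  have hm : m - Finsupp.single (c k) (D (c k)) + Finsupp.single (c k) (D (c k)) = m :=
    tsub_add_cancel_of_le (Finsupp.single_le_iff.2 hk)
  rw [← hm, divModProd_add_single _ _ (hD _)]
  exact Ideal.mul_mem_right _ _ (Ideal.subset_span ⟨k, rfl⟩)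

/-- The exponent vectors of a given degree. -/
abbrev DegExp (ι : Type*) (t : ℕ) : Type _ := {m : ι →₀ ℕ // m.degree = t}

noncomputable instance (t : ℕ) : Fintype (DegExp ι t) :=
  (Finsupp.finite_of_degree_eq t).fintype

/-- The matrix of the products `divModProd D g m` of degree `t` in the monomial basis. -/
noncomputable def divModMatrix (D : ι → ℕ) (g : ι → MvPolynomial ι A) (t : ℕ) :
    Matrix (DegExp ι t) (DegExp ι t) A :=
  fun m' m => coeff m'.1 (divModProd D g m.1)

variable [DecidableEq ι]

theorem map_divModMatrix {A' : Type*} [CommRing A'] (φ : A →+* A') (t : ℕ) :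
    φ.mapMatrix (divModMatrix D g t) = divModMatrix D (fun i => map φ (g i)) t := by
  ext m' m
  simp [divModMatrix, ← map_divModProd, coeff_map]

theorem divModMatrix_X_pow (t : ℕ) :
    divModMatrix D (fun i => (X i : MvPolynomial ι A) ^ D i) t = 1 := by
  ext m' m
  simp only [divModMatrix, divModProd_X_pow, coeff_monomial, Matrix.one_apply, Subtype.ext_iff]
  simp [eq_comm]

theorem det_divModMatrix_map_ne_zero {K L : Type*} [CommRing K] [CommRing L] [Nontrivial L]
    (φ : A →+* K) (hφ : Function.Injective φ) (ψ : A →+* L)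
    (hψ : ∀ i, map ψ (g i) = X i ^ D i) (t : ℕ) :
    (divModMatrix D (fun i => map φ (g i)) t).det ≠ 0 := by
  rw [← map_divModMatrix, ← RingHom.map_det, map_ne_zero_iff φ hφ]
  intro h
  have := RingHom.map_det ψ (divModMatrix D g t)
  rw [map_divModMatrix, funext hψ, divModMatrix_X_pow, h] at this
  simp at this

end DivModProd

section Basis

variable {ι K : Type*} [Fintype ι] [DecidableEq ι] [Field K] {D : ι → ℕ} {g : ι → MvPolynomial ι K}

theorem linearIndependent_divModProd (hg : ∀ i, (g i).IsHomogeneous (D i))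
    (hdet : ∀ t, (divModMatrix D g t).det ≠ 0) : LinearIndependent K (divModProd D g) := by
  let l : (ι →₀ ℕ) → Module.Dual K (MvPolynomial ι K) := fun m =>
    ∑ m' : DegExp ι m.degree, (divModMatrix D g m.degree)⁻¹ ⟨m, rfl⟩ m' • lcoeff K m'.1
  have key : ∀ m m', m'.degree = m.degree →
      l m (divModProd D g m') = if m = m' then 1 else 0 := by
    intro m m' h
    have := Matrix.nonsing_inv_mul _ (hdet m.degree).isUnit
    have := congrFun (congrFun this ⟨m, rfl⟩) ⟨m', h⟩
    simpa [Matrix.mul_apply, Matrix.one_apply, l, divModMatrix] using this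
  refine LinearIndependent.of_pairwise_dual_eq_zero_one _ l (fun m m' hne => ?_) fun m => ?_
  · change l m (divModProd D g m') = 0
    by_cases h : m'.degree = m.degree
    · rw [key m m' h, if_neg hne]
    · have : ∀ x : DegExp ι m.degree, coeff x.1 (divModProd D g m') = 0 := fun x =>
        (isHomogeneous_divModProd hg m').coeff_eq_zero (by rw [x.2]; exact Ne.symm h)
      simp [l, this]
  · rw [key m m rfl, if_pos rfl]

theorem span_divModProd (hg : ∀ i, (g i).IsHomogeneous (D i))
    (hdet : ∀ t, (divModMatrix D g t).det ≠ 0) :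
    ⊤ ≤ Submodule.span K (Set.range (divModProd D g)) := by
  have key : ∀ m, monomial m (1 : K) ∈ Submodule.span K (Set.range (divModProd D g)) := by
    intro m
    have : monomial m (1 : K) = ∑ m' : DegExp ι m.degree,
        (divModMatrix D g m.degree)⁻¹ m' ⟨m, rfl⟩ • divModProd D g m'.1 := by
      ext x
      by_cases h : x.degree = m.degree
      · have := Matrix.mul_nonsing_inv _ (hdet m.degree).isUnit
        have := congrFun (congrFun this ⟨x, h⟩) ⟨m, rfl⟩
        simp only [Matrix.mul_apply, Matrix.one_apply, divModMatrix, Subtype.ext_iff] at this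
        simp only [coeff_monomial, coeff_sum, coeff_smul, smul_eq_mul, eq_comm (a := m), ← this]
        exact Finset.sum_congr rfl fun _ _ => mul_comm _ _
      · have h0 : ∀ m' : DegExp ι m.degree, coeff x (divModProd D g m'.1) = 0 := fun m' =>
          (isHomogeneous_divModProd hg _).coeff_eq_zero (by rw [m'.2]; exact h)
        have hne : m ≠ x := fun e => h (by rw [e])
        simp [coeff_sum, h0, coeff_monomial, hne]
    rw [this]
    exact Submodule.sum_mem _ fun m' _ => Submodule.smul_mem _ _ (Submodule.subset_span ⟨_, rfl⟩)
  intro p _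
  rw [p.as_sum]
  refine Submodule.sum_mem _ fun m _ => ?_
  have := Submodule.smul_mem _ (coeff m p) (key m)
  rwa [smul_monomial, smul_eq_mul, mul_one] at this

/-- The products `divModProd D g m` as a basis of the polynomial ring. -/
noncomputable def divModBasis (hg : ∀ i, (g i).IsHomogeneous (D i))
    (hdet : ∀ t, (divModMatrix D g t).det ≠ 0) :
    Module.Basis (ι →₀ ℕ) K (MvPolynomial ι K) :=
  Module.Basis.mk (linearIndependent_divModProd hg hdet) (span_divModProd hg hdet)

theorem divModBasis_apply (hg : ∀ i, (g i).IsHomogeneous (D i))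
    (hdet : ∀ t, (divModMatrix D g t).det ≠ 0)
    (m : ι →₀ ℕ) : divModBasis hg hdet m = divModProd D g m :=
  Module.Basis.mk_apply _ _ m

theorem divModBasis_repr_mul (hg : ∀ i, (g i).IsHomogeneous (D i))
    (hdet : ∀ t, (divModMatrix D g t).det ≠ 0)
    (p : MvPolynomial ι K) (j : ι) (hD : 0 < D j) :
    (divModBasis hg hdet).repr (g j * p) =
      ((divModBasis hg hdet).repr p).mapDomain (· + Finsupp.single j (D j)) := by
  let b := divModBasis hg hdet
  have : b.repr.toLinearMap ∘ₗ LinearMap.mulLeft K (g j) =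
      Finsupp.lmapDomain K K (· + Finsupp.single j (D j)) ∘ₗ b.repr.toLinearMap := by
    refine b.ext fun m => ?_
    have h : g j * b m = b (m + Finsupp.single j (D j)) := by
      simp only [b, divModBasis_apply, divModProd_add_single _ _ hD]
    simp [h]
  exact LinearMap.congr_fun this p

theorem mem_span_iff_divModBasis_repr (hg : ∀ i, (g i).IsHomogeneous (D i))
    (hdet : ∀ t, (divModMatrix D g t).det ≠ 0)
    {κ : Type*} [Fintype κ] (c : κ → ι) (hD : ∀ i, 0 < D i)
    (p : MvPolynomial ι K) :
    p ∈ Ideal.span (Set.range fun k => g (c k)) ↔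
      ∀ m ∈ ((divModBasis hg hdet).repr p).support, ∃ k, D (c k) ≤ m (c k) := by
  constructor
  · intro hp m hm
    obtain ⟨a, rfl⟩ := Ideal.mem_span_range_iff_exists_fun.1 hp
    rw [map_sum] at hm
    obtain ⟨k, -, hk⟩ := Finset.mem_biUnion.1 (Finsupp.support_finsetSum hm)
    rw [mul_comm, divModBasis_repr_mul _ _ _ _ (hD _)] at hk
    obtain ⟨m', -, rfl⟩ := Finset.mem_image.1 (Finsupp.mapDomain_support hk)
    exact ⟨k, by simp⟩
  · intro h
    rw [← (divModBasis hg hdet).linearCombination_repr p, Finsupp.linearCombination_apply]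
    refine Submodule.sum_mem _ fun m hm => ?_
    obtain ⟨k, hk⟩ := h m hm
    simp only [divModBasis_apply]
    exact Submodule.smul_of_tower_mem _ _ (divModProd_mem_span c hD m k hk)

/-- A member of the family `g` not among the `g (c k)` is a nonzerodivisor modulo their ideal. -/
theorem mem_span_of_mul_mem_span (hg : ∀ i, (g i).IsHomogeneous (D i))
    (hdet : ∀ t, (divModMatrix D g t).det ≠ 0)
    {κ : Type*} [Fintype κ] (c : κ → ι) (hD : ∀ i, 0 < D i)
    (j : ι) (hj : ∀ k, c k ≠ j) (p : MvPolynomial ι K)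
    (hp : g j * p ∈ Ideal.span (Set.range fun k => g (c k))) :
    p ∈ Ideal.span (Set.range fun k => g (c k)) := by
  rw [mem_span_iff_divModBasis_repr hg hdet c hD] at hp ⊢
  intro m hm
  obtain ⟨k, hk⟩ := hp (m + Finsupp.single j (D j)) (by
    rw [divModBasis_repr_mul _ _ _ _ (hD j),
      Finsupp.mapDomain_support_of_injective (add_left_injective _)]
    exact Finset.mem_image_of_mem _ hm)
  exact ⟨k, by simpa [Finsupp.single_apply, (hj k).symm] using hk⟩

/-- Every form of degree larger than `∑ (Dᵢ - 1)` lies in the ideal of the family `g`. -/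
theorem mem_span_of_isHomogeneous (hg : ∀ i, (g i).IsHomogeneous (D i))
    (hdet : ∀ t, (divModMatrix D g t).det ≠ 0)
    (hD : ∀ i, 0 < D i) {t : ℕ} (ht : ∑ i, (D i - 1) < t)
    {p : MvPolynomial ι K} (hp : p.IsHomogeneous t) : p ∈ Ideal.span (Set.range g) := by
  have key : ∀ m : ι →₀ ℕ, m.degree = t → divModProd D g m ∈ Ideal.span (Set.range g) := by
    intro m hm
    obtain ⟨i, hi⟩ : ∃ i, D i ≤ m i := by
      by_contra! h
      have : ∑ i, m i ≤ ∑ i, (D i - 1) := Finset.sum_le_sum fun i _ => Nat.le_sub_one_of_lt (h i)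
      rw [← Finsupp.degree_eq_sum] at this
      omega
    exact divModProd_mem_span id hD m i hi
  rw [← homogeneousComponent_eq_self hp,
    ← (divModBasis hg hdet).linearCombination_repr p, Finsupp.linearCombination_apply,
    Finsupp.sum, map_sum]
  refine Submodule.sum_mem _ fun m _ => ?_
  rw [map_smul, divModBasis_apply, homogeneousComponent_of_mem
    ((mem_homogeneousSubmodule _ _).2 (isHomogeneous_divModProd hg m))]
  split_ifs with h
  · exact Submodule.smul_of_tower_mem _ _ (key m h.symm)
  · simp

end Basis

/-! ### Generic sequences -/

section Generic

variable {F K : Type*} [Field F] [Field K] [Algebra F K] {n : ℕ} {d : Fin n → ℕ}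
  {f : Fin n → MvPolynomial (Fin (n + 1)) K}

theorem expDeg_eq_degree {n : ℕ} (μ : Fin n →₀ ℕ) : expDeg μ = μ.degree := rfl

theorem IsGenericSeq.isHomogeneous_snoc (hf : IsGenericSeq F d f) (i : Fin (n + 1)) :
    (Fin.snoc (α := fun _ => MvPolynomial (Fin (n + 1)) K) f (X (Fin.last n)) i).IsHomogeneous
      (Fin.snoc (α := fun _ => ℕ) d 1 i) := by
  induction i using Fin.lastCases with
  | last => simpa using isHomogeneous_X K (Fin.last n)
  | cast i => simpa using hf.1 i

variable (F d) in
/-- The forms of degrees `d i` whose coefficients are independent variables over `F`. -/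
noncomputable def universalForm (i : Fin n) : MvPolynomial (Fin (n + 1))
    (MvPolynomial (Σ i : Fin n, {μ : Fin (n + 1) →₀ ℕ // expDeg μ = d i}) F) :=
  ∑ μ : DegExp (Fin (n + 1)) (d i), monomial μ.1 (X ⟨i, μ⟩)

theorem map_universalForm {A : Type*} [CommRing A]
    (φ : MvPolynomial (Σ i : Fin n, {μ : Fin (n + 1) →₀ ℕ // expDeg μ = d i}) F →+* A) (i : Fin n)
    {p : MvPolynomial (Fin (n + 1)) A} (hp : p.IsHomogeneous (d i))
    (h : ∀ μ, φ (X ⟨i, μ⟩) = coeff μ.1 p) : map φ (universalForm F d i) = p := by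
  ext ν
  simp only [universalForm, map_sum, map_monomial, coeff_sum, coeff_monomial]
  by_cases hν : ν.degree = d i
  · rw [Finset.sum_eq_single ⟨ν, hν⟩]
    · exact (if_pos rfl).trans (h ⟨ν, hν⟩)
    · exact fun μ _ hne => if_neg fun e => hne (Subtype.ext e)
    · simp
  · rw [hp.coeff_eq_zero hν]
    refine Finset.sum_eq_zero fun μ _ => if_neg ?_
    rintro rfl
    exact hν μ.2

theorem IsGenericSeq.det_divModMatrix_ne_zero (hf : IsGenericSeq F d f) (t : ℕ) :
    (divModMatrix (Fin.snoc (α := fun _ => ℕ) d 1)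
      (Fin.snoc (α := fun _ => MvPolynomial (Fin (n + 1)) K) f (X (Fin.last n))) t).det ≠ 0 := by
  let σ := Σ i : Fin n, {μ : Fin (n + 1) →₀ ℕ // expDeg μ = d i}
  let φ : MvPolynomial σ F →+* K := (aeval fun p : σ => (f p.1).coeff p.2.1).toRingHom
  let ψ : MvPolynomial σ F →+* F :=
    (aeval fun p : σ => coeff p.2.1 (X (R := F) p.1.castSucc ^ d p.1)).toRingHom
  have hφ : (fun i => map φ (Fin.snoc (α := fun _ => MvPolynomial (Fin (n + 1)) (MvPolynomial σ F))
      (universalForm F d) (X (Fin.last n)) i)) = Fin.snoc f (X (Fin.last n)) := by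
    funext i
    induction i using Fin.lastCases with
    | last => simp
    | cast i => simpa using map_universalForm φ i (hf.1 i) (by simp [φ])
  rw [← hφ]
  refine det_divModMatrix_map_ne_zero φ hf.2 ψ (fun i => ?_) t
  induction i using Fin.lastCases with
  | last => simp
  | cast i =>
    simpa using map_universalForm ψ i (p := X i.castSucc ^ d i) (isHomogeneous_X_pow _ _)
      (by simp [ψ])

end Generic

/-! ### Initial ideals and the last variable -/

section InitialIdeal

variable {K : Type*} {n : ℕ}

theorem monomial_mem_initialIdeal_iff [Field K] {I : Ideal (MvPolynomial (Fin n) K)}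
    {μ : Fin n →₀ ℕ} :
    monomial μ (1 : K) ∈ initialIdeal I ↔ ∃ p ∈ I, ∃ ν, IsLeadExp p ν ∧ ν ≤ μ := by
  have : { m | ∃ p ∈ I, p ≠ 0 ∧ ∃ μ, IsLeadExp p μ ∧ m = monomial μ (1 : K) } =
      (fun s => monomial s (1 : K)) '' {ν | ∃ p ∈ I, IsLeadExp p ν} := by
    ext m
    constructor
    · rintro ⟨p, hp, -, ν, hν, rfl⟩
      exact ⟨ν, ⟨p, hp, hν⟩, rfl⟩
    · rintro ⟨ν, ⟨p, hp, hν⟩, rfl⟩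
      exact ⟨p, hp, support_nonempty.1 ⟨ν, hν.1⟩, ν, hν, rfl⟩
  rw [initialIdeal, this, mem_ideal_span_monomial_image]
  constructor
  · intro h
    obtain ⟨ν, ⟨p, hp, hν⟩, hle⟩ := h μ (by simp)
    exact ⟨p, hp, ν, hν, hle⟩
  · rintro ⟨p, hp, ν, hν, h⟩ μ' hμ'
    rw [Finset.mem_singleton.1 (support_monomial_subset hμ')]
    exact ⟨ν, ⟨p, hp, hν⟩, h⟩

theorem IsLeadExp.homogeneousComponent [CommRing K] {p : MvPolynomial (Fin n) K}
    {μ : Fin n →₀ ℕ} (h : IsLeadExp p μ) :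
    IsLeadExp (homogeneousComponent μ.degree p) μ := by
  refine ⟨?_, fun ν hν => h.2 ν ?_⟩
  · simpa [coeff_homogeneousComponent] using h.1
  · simp only [mem_support_iff, coeff_homogeneousComponent, ne_eq, ite_eq_right_iff] at hν ⊢
    tauto

@[simp]
theorem embExp_castSucc (a : Fin n →₀ ℕ) (i : Fin n) : embExp a i.castSucc = a i :=
  Finsupp.embDomain_apply_self ⟨Fin.castSucc, Fin.castSucc_injective n⟩ a i

@[simp]
theorem embExp_last (a : Fin n →₀ ℕ) : embExp a (Fin.last n) = 0 :=
  Finsupp.embDomain_of_notMem_range _ _ _ (by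
    rintro ⟨i, hi⟩
    exact (Fin.castSucc_lt_last i).ne hi)

@[simp]
theorem zShift_castSucc (k : ℕ) (μ : Fin (n + 1) →₀ ℕ) (i : Fin n) :
    zShift k μ i.castSucc = μ i.castSucc := by
  simp [zShift, (Fin.castSucc_lt_last i).ne]

@[simp]
theorem zShift_last (k : ℕ) (μ : Fin (n + 1) →₀ ℕ) :
    zShift k μ (Fin.last n) = μ (Fin.last n) + k := by
  simp [zShift]

theorem exists_eq_zShift_embExp (μ : Fin (n + 1) →₀ ℕ) : ∃ k a, μ = zShift k (embExp a) := by
  refine ⟨μ (Fin.last n), Finsupp.equivFunOnFinite.symm fun i => μ i.castSucc, ?_⟩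
  ext i
  induction i using Fin.lastCases <;> simp

theorem zShift_zShift (k l : ℕ) (μ : Fin (n + 1) →₀ ℕ) :
    zShift k (zShift l μ) = zShift (l + k) μ := by
  simp [zShift, add_assoc]

theorem zShift_zero (μ : Fin (n + 1) →₀ ℕ) : zShift 0 μ = μ := by
  simp [zShift]

theorem degree_zShift_embExp (k : ℕ) (a : Fin n →₀ ℕ) :
    (zShift k (embExp a)).degree = a.degree + k := by
  simp [Finsupp.degree_eq_sum, Fin.sum_univ_castSucc]

theorem zShift_embExp_le_iff {k l : ℕ} {a b : Fin n →₀ ℕ} :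
    zShift k (embExp a) ≤ zShift l (embExp b) ↔ a ≤ b ∧ k ≤ l := by
  simp [Finsupp.le_def, Fin.forall_fin_succ']

theorem zShift_embExp_inj {k l : ℕ} {a b : Fin n →₀ ℕ} :
    zShift k (embExp a) = zShift l (embExp b) ↔ a = b ∧ k = l := by
  simp [Finsupp.ext_iff, Fin.forall_fin_succ']

theorem drlLT_zShift_embExp_iff {k : ℕ} {a b : Fin n →₀ ℕ} :
    DrlLT (zShift k (embExp a)) (zShift k (embExp b)) ↔ DrlLT a b := by
  simp [DrlLT, expDeg_eq_degree, degree_zShift_embExp, Fin.exists_fin_succ',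
    Fin.forall_fin_succ']

theorem projMap_rename [CommRing K] (p : MvPolynomial (Fin n) K) :
    projMap K n (rename Fin.castSucc p) = p := by
  rw [projMap, aeval_rename]
  simp [Function.comp_def]

theorem projMap_surjective [CommRing K] : Function.Surjective (projMap K n) :=
  fun p => ⟨_, projMap_rename p⟩

theorem projMap_X_last [CommRing K] : projMap K n (X (Fin.last n)) = 0 := by
  simp [projMap]

theorem projMap_monomial_zShift [CommRing K] (k : ℕ) (a : Fin n →₀ ℕ) (c : K) :
    projMap K n (monomial (zShift k (embExp a)) c) = monomial a c * 0 ^ k := by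
  have : monomial (zShift k (embExp a)) c =
      rename Fin.castSucc (monomial a c) * X (Fin.last n) ^ k := by
    rw [rename_monomial, X_pow_eq_monomial, monomial_mul, mul_one, zShift, embExp,
      Finsupp.embDomain_eq_mapDomain]
    rfl
  rw [this, map_mul, map_pow, projMap_rename, projMap_X_last]

theorem coeff_projMap [CommRing K] (p : MvPolynomial (Fin (n + 1)) K) (a : Fin n →₀ ℕ) :
    coeff a (projMap K n p) = coeff (embExp a) p := by
  induction p using MvPolynomial.induction_on' with
  | add p q hp hq => simp [hp, hq]
  | monomial μ c =>
    obtain ⟨k, b, rfl⟩ := exists_eq_zShift_embExp μ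
    rw [projMap_monomial_zShift, ← zShift_zero (embExp a), coeff_monomial]
    simp only [zShift_embExp_inj]
    rcases k with - | k <;> simp [coeff_monomial]

/-- If `I` is homogeneous and `z` is a nonzerodivisor modulo `I`, then the initial ideal of `I` is
extended from the initial ideal of the image of `I` under `z ↦ 0`. -/
theorem monomial_zShift_mem_initialIdeal_iff [Field K]
    {I : Ideal (MvPolynomial (Fin (n + 1)) K)}
    (hI : ∀ p ∈ I, ∀ t, homogeneousComponent t p ∈ I)
    (hz : ∀ p, X (Fin.last n) * p ∈ I → p ∈ I) (k : ℕ) (a : Fin n →₀ ℕ) :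
    monomial (zShift k (embExp a)) (1 : K) ∈ initialIdeal I ↔
      monomial a (1 : K) ∈ initialIdeal (I.map (projMap K n)) := by
  rw [monomial_mem_initialIdeal_iff, monomial_mem_initialIdeal_iff]
  constructor
  · rintro ⟨p, hp, ν, hν, hle⟩
    obtain ⟨l, b, rfl⟩ := exists_eq_zShift_embExp ν
    have hq := hν.homogeneousComponent
    have hqI := hI p hp (zShift l (embExp b)).degree
    have hqh := homogeneousComponent_isHomogeneous (zShift l (embExp b)).degree p
    generalize homogeneousComponent (zShift l (embExp b)).degree p = q at hq hqI hqh
    set s : Fin (n + 1) →₀ ℕ := Finsupp.single (Fin.last n) l with hs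
    have hsupp : ∀ μ ∈ q.support, l ≤ μ (Fin.last n) := by
      intro μ hμ
      by_cases h : μ = zShift l (embExp b)
      · simp [h]
      rcases hq.2 μ hμ h with h | ⟨-, i, hi, hj⟩
      · exact absurd (hqh.degree_eq_sum_deg_support hμ) h.ne'
      · induction i using Fin.lastCases with
        | last => simp at hi; omega
        | cast i => simp [hj _ (Fin.castSucc_lt_last i)]
    have hmod : q.modMonomial s = 0 := by
      ext μ
      by_cases h : s ≤ μ
      · simp [coeff_modMonomial_of_le _ h]
      · rw [coeff_modMonomial_of_not_le _ h, coeff_zero]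
        by_contra h0
        exact h (Finsupp.single_le_iff.2 (hsupp μ (mem_support_iff.2 h0)))
    have hdiv := divMonomial_add_modMonomial q s
    rw [hmod, add_zero, hs, ← X_pow_eq_monomial, ← hs] at hdiv
    have hpow : ∀ j g, X (Fin.last n) ^ j * g ∈ I → g ∈ I := by
      intro j
      induction j with
      | zero => simp
      | succ j ih => exact fun g hg => ih g (hz _ (by rwa [← mul_assoc, ← pow_succ']))
    have hg : q.divMonomial s ∈ I := hpow l _ (by rwa [hdiv])
    have hcoeff : ∀ c, coeff c (projMap K n (q.divMonomial s)) = coeff (zShift l (embExp c)) q := by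
      intro c
      rw [coeff_projMap, coeff_divMonomial, add_comm s]
      rfl
    refine ⟨_, Ideal.mem_map_of_mem _ hg, b, ⟨?_, fun c hc hne => ?_⟩,
      (zShift_embExp_le_iff.1 hle).1⟩
    · rw [mem_support_iff, hcoeff]
      exact mem_support_iff.1 hq.1
    · rw [mem_support_iff, hcoeff] at hc
      exact drlLT_zShift_embExp_iff.1 (hq.2 _ (mem_support_iff.2 hc) fun h =>
        hne (zShift_embExp_inj.1 h).1)
  · rintro ⟨p, hp, b, hb, hle⟩
    obtain ⟨g, hg, rfl⟩ := (Ideal.mem_map_iff_of_surjective _ projMap_surjective).1 hp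
    have hdeg : (zShift 0 (embExp b)).degree = b.degree := degree_zShift_embExp 0 b
    refine ⟨_, hI g hg b.degree, zShift 0 (embExp b), ⟨?_, fun ν hν hne => ?_⟩,
      zShift_embExp_le_iff.2 ⟨hle, zero_le⟩⟩
    · rw [mem_support_iff, coeff_homogeneousComponent, if_pos hdeg, zShift_zero, ← coeff_projMap]
      exact mem_support_iff.1 hb.1
    · simp only [mem_support_iff, coeff_homogeneousComponent, ne_eq, ite_eq_right_iff,
        Classical.not_imp] at hν
      obtain ⟨l, c, rfl⟩ := exists_eq_zShift_embExp ν
      rcases l.eq_zero_or_pos with rfl | hl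
      · refine drlLT_zShift_embExp_iff.2 (hb.2 c ?_ fun h => hne (by rw [h]))
        rw [mem_support_iff, coeff_projMap, ← zShift_zero (embExp c)]
        exact hν.2
      · exact Or.inr ⟨hν.1.trans hdeg.symm, Fin.last n, by simpa using hl,
          fun j hj => absurd hj (Fin.le_last j).not_gt⟩

theorem mem_stdMon_iff [Field K] {I : Ideal (MvPolynomial (Fin n) K)} {i : ℕ} {μ : Fin n →₀ ℕ} :
    μ ∈ stdMon I i ↔ μ.degree = i ∧ monomial μ (1 : K) ∉ initialIdeal I := Iff.rfl

theorem monomial_mem_initialIdeal_of_mem [Field K] {I : Ideal (MvPolynomial (Fin n) K)}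
    {μ : Fin n →₀ ℕ} (h : monomial μ (1 : K) ∈ I) : monomial μ (1 : K) ∈ initialIdeal I :=
  monomial_mem_initialIdeal_iff.2 ⟨_, h, μ, ⟨by simp, fun _ hν hne =>
    absurd (Finset.mem_singleton.1 (support_monomial_subset hν)) hne⟩, le_rfl⟩

end InitialIdeal

section Generic

variable {F K : Type*} [Field F] [Field K] [Algebra F K] {n : ℕ} {d : Fin n → ℕ}
  {f : Fin n → MvPolynomial (Fin (n + 1)) K}

theorem homogeneousComponent_mem_span_range (hf : ∀ i, (f i).IsHomogeneous (d i))
    {p : MvPolynomial (Fin (n + 1)) K} (hp : p ∈ Ideal.span (Set.range f)) (t : ℕ) :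
    homogeneousComponent t p ∈ Ideal.span (Set.range f) := by
  let _ := gradedAlgebra (σ := Fin (n + 1)) (R := K)
  refine homogeneousComponent_mem_of_mem (Ideal.homogeneous_span _ _ ?_) hp t
  rintro _ ⟨i, rfl⟩
  exact ⟨d i, hf i⟩

theorem snoc_one_pos (hd : ∀ i, 1 ≤ d i) (i : Fin (n + 1)) :
    0 < Fin.snoc (α := fun _ => ℕ) d 1 i := by
  induction i using Fin.lastCases with
  | last => simp
  | cast i => simpa using Nat.lt_of_succ_le (hd i)

/-- The last variable is a nonzerodivisor modulo an ideal of `n` generic forms in `n + 1`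
variables. -/
theorem IsGenericSeq.mem_of_X_last_mul_mem (hd : ∀ i, 1 ≤ d i) (hf : IsGenericSeq F d f)
    {p : MvPolynomial (Fin (n + 1)) K} (hp : X (Fin.last n) * p ∈ Ideal.span (Set.range f)) :
    p ∈ Ideal.span (Set.range f) := by
  have := mem_span_of_mul_mem_span hf.isHomogeneous_snoc hf.det_divModMatrix_ne_zero
    Fin.castSucc (snoc_one_pos hd) (Fin.last n) (fun k => (Fin.castSucc_lt_last k).ne) p
  simp only [Fin.snoc_castSucc, Fin.snoc_last] at this
  exact this hp

/-- Monomials of degree larger than `∑ dᵢ - n` lie in the image under `z ↦ 0` of an ideal of `n`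
generic forms in `n + 1` variables. -/
theorem IsGenericSeq.monomial_mem_map_projMap (hd : ∀ i, 1 ≤ d i) (hf : IsGenericSeq F d f)
    {a : Fin n →₀ ℕ} (ha : (∑ i, d i) - n < a.degree) :
    monomial a (1 : K) ∈ (Ideal.span (Set.range f)).map (projMap K n) := by
  have hsum : ∑ i, (Fin.snoc (α := fun _ => ℕ) d 1 i - 1) < a.degree := by
    have : ∑ i, (d i - 1) + n = ∑ i, d i := by
      rw [← Finset.sum_congr rfl fun i _ => Nat.sub_add_cancel (hd i)]
      simp [Finset.sum_add_distrib]
    simp [Fin.sum_univ_castSucc]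
    omega
  have hmem := mem_span_of_isHomogeneous hf.isHomogeneous_snoc hf.det_divModMatrix_ne_zero
    (snoc_one_pos hd) hsum
    (isHomogeneous_monomial (d := zShift 0 (embExp a)) 1 (degree_zShift_embExp 0 a))
  have hmap := Ideal.mem_map_of_mem (projMap K n) hmem
  rw [projMap_monomial_zShift, pow_zero, mul_one, Ideal.map_span] at hmap
  refine Ideal.span_le.2 ?_ hmap
  rintro _ ⟨_, ⟨i, rfl⟩, rfl⟩
  induction i using Fin.lastCases with
  | last => simp [projMap_X_last]
  | cast i =>
    rw [Fin.snoc_castSucc]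
    exact Ideal.mem_map_of_mem _ (Ideal.subset_span ⟨i, rfl⟩)

end Generic

/-- for a generic ideal `I` of type `(n+1; d_1,…,d_n)` in `K[x_1,…,x_n,z]` with
standard monomials `E` and `B` the standard monomials of `J = π(I)`:
`E_i = B_i ∪ z·B_{i−1} ∪ ⋯ ∪ z^i·B_0` for `0 ≤ i ≤ δ` and `E_i = z^{i−δ}·E_δ` for `i > δ`. -/
theorem stmt13 {F K : Type*} [Field F] [Field K] [Algebra F K] [Infinite K]
    {n : ℕ} (d : Fin n → ℕ) (hd : ∀ i, 1 ≤ d i)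
    (f : Fin n → MvPolynomial (Fin (n + 1)) K) (hf : IsGenericSeq F d f)
    (I : Ideal (MvPolynomial (Fin (n + 1)) K)) (hI : I = Ideal.span (Set.range f))
    (J : Ideal (MvPolynomial (Fin n) K)) (hJ : J = I.map (projMap K n))
    (δ : ℕ) (hδ : δ = (∑ j, d j) - n) :
    (∀ i : ℕ, i ≤ δ →
      stdMon I i = ⋃ k ∈ Finset.range (i + 1), zShift k '' (embExp '' stdMon J (i - k))) ∧
    (∀ i : ℕ, δ < i → stdMon I i = zShift (i - δ) '' stdMon I δ) := by
  subst hδ hJ hI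
  set I := Ideal.span (Set.range f)
  set J := I.map (projMap K n)
  have hmem (k : ℕ) (a : Fin n →₀ ℕ) (i : ℕ) :
      zShift k (embExp a) ∈ stdMon I i ↔ a.degree + k = i ∧ a ∈ stdMon J a.degree := by
    rw [mem_stdMon_iff, mem_stdMon_iff, degree_zShift_embExp,
      monomial_zShift_mem_initialIdeal_iff
        (fun _ hp t => homogeneousComponent_mem_span_range hf.1 hp t)
        (fun _ hp => hf.mem_of_X_last_mul_mem hd hp)]
    exact ⟨fun h => ⟨h.1, rfl, h.2⟩, fun h => ⟨h.1, h.2.2⟩⟩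
  have hle (a : Fin n →₀ ℕ) (h : a ∈ stdMon J a.degree) : a.degree ≤ (∑ j, d j) - n :=
    not_lt.1 fun hlt => h.2 (monomial_mem_initialIdeal_of_mem (hf.monomial_mem_map_projMap hd hlt))
  constructor
  · intro i _
    ext μ
    simp only [Set.mem_iUnion, Finset.mem_range, exists_prop, Set.mem_image,
      exists_exists_and_eq_and]
    constructor
    · intro hμ
      obtain ⟨k, a, rfl⟩ := exists_eq_zShift_embExp μ
      obtain ⟨rfl, ha⟩ := (hmem k a i).1 hμ
      exact ⟨k, by omega, a, by rwa [Nat.add_sub_cancel], rfl⟩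
    · rintro ⟨k, hk, a, ha, rfl⟩
      have hdeg : a.degree = i - k := ha.1
      exact (hmem k a i).2 ⟨by omega, by rwa [hdeg]⟩
  · intro i hi
    ext μ
    constructor
    · intro hμ
      obtain ⟨k, a, rfl⟩ := exists_eq_zShift_embExp μ
      obtain ⟨rfl, ha⟩ := (hmem k a i).1 hμ
      have := hle a ha
      refine ⟨zShift ((∑ j, d j) - n - a.degree) (embExp a), (hmem _ _ _).2 ⟨by omega, ha⟩, ?_⟩
      rw [zShift_zShift]
      congr 1
      omega
    · rintro ⟨ν, hν, rfl⟩
      obtain ⟨k, a, rfl⟩ := exists_eq_zShift_embExp ν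
      obtain ⟨h, ha⟩ := (hmem _ _ _).1 hν
      rw [zShift_zShift]
      exact (hmem _ _ _).2 ⟨by omega, ha⟩
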